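/- Let n, m ∈ ℕ, k ∈ ℕ^n with K = Σ_i k_i ≥ 1, K₂ = Σ_i k_i(k_i − 1), u ∈ ℕ^m, and L(k,u) = {α ∈ ℕ^m : α_j ≤ u_j for all j, and Σ_j α_j = K} nonempty. Let c_j : ℕ → ℝ (j = 1,…,m) be non-decreasing cost functions, T ≥ 0, and Φ̄(α) = Σ_{j=1}^m Σ_{t=1}^{α_j} c_j(t). Then the K-homogeneous generating polynomial g(x₁,…,x_m) = Σ_{α ∈ L(k,u)} (K!/(k!·α!))·exp(−(K₂/K²)·Σ_{j=1}^m α_j(α_j − 1))·exp(−T·Φ̄(α))·x^α, where k! = Π_i k_i!, α! = Π_j α_j! and x^α = Π_j x_j^{α_j}, is strongly log-concave. -/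

import Mathlib

open Finset MvPolynomial

/-- Iterated partial derivative `∂^β p`, applying `∂/∂x_j` exactly `β j` times. -/
noncomputable def pderivMulti {m : ℕ} (β : Fin m → ℕ) (p : MvPolynomial (Fin m) ℝ) :
    MvPolynomial (Fin m) ℝ :=
  (List.finRange m).foldr (fun j acc => (fun r => MvPolynomial.pderiv j r)^[β j] acc) p

/-- Strong log-concavity of a polynomial with nonnegative coefficients. -/
noncomputable def StronglyLogConcave {m : ℕ} (p : MvPolynomial (Fin m) ℝ) : Prop :=
  ∀ β : Fin m → ℕ, ∀ x : Fin m → ℝ, (∀ j, 0 ≤ x j) →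
    0 < MvPolynomial.eval x (pderivMulti β p) →
    (-(Matrix.of fun i j : Fin m =>
        MvPolynomial.eval x (pderivMulti β p)
            * MvPolynomial.eval x (MvPolynomial.pderiv i (MvPolynomial.pderiv j (pderivMulti β p)))
          - MvPolynomial.eval x (MvPolynomial.pderiv i (pderivMulti β p))
            * MvPolynomial.eval x (MvPolynomial.pderiv j (pderivMulti β p)))).PosSemidef

/-- The set `L(k,u) = {α ∈ ℕ^m : α ≤ u, Σ_j α_j = K}` of feasible resource load
profiles. -/
def feasibleLoads {m : ℕ} (u : Fin m → ℕ) (K : ℕ) : Finset (Fin m → ℕ) :=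
  (Fintype.piFinset fun j : Fin m => Finset.range (u j + 1)).filter fun α => (∑ j, α j) = K

/-- Rosenthal's potential on resource load profiles:
`Φ̄(α) = Σ_{j=1}^m Σ_{t=1}^{α_j} c_j(t)`. -/
noncomputable def rosenthalLoad {m : ℕ} (c : Fin m → ℕ → ℝ) (α : Fin m → ℕ) : ℝ :=
  ∑ j : Fin m, ∑ t ∈ Finset.Icc 1 (α j), c j t


section LinAlg

lemma slc_spectral {m : ℕ} (S : Fin m → Fin m → ℝ) (hS : ∀ i j, S i j = S j i) :
    ∃ (b : Fin m → Fin m → ℝ) (l : Fin m → ℝ),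
      (∀ k i, ∑ j, S i j * b k j = l k * b k i) ∧ (∀ k, ∑ i, b k i ^ 2 = 1) ∧
      (∀ w z : Fin m → ℝ, ∑ k, (∑ i, w i * b k i) * (∑ i, b k i * z i) = ∑ i, w i * z i) := by
  have hA : (Matrix.of S).IsHermitian := by
    ext i j; simp [hS i j]
  refine ⟨fun k => (hA.eigenvectorBasis k).ofLp, hA.eigenvalues, ?_, ?_, ?_⟩
  · intro k i
    have := congrFun (hA.mulVec_eigenvectorBasis k) i
    simpa [Matrix.mulVec, dotProduct] using this
  · intro k
    have := hA.eigenvectorBasis.orthonormal.1 k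
    rw [EuclideanSpace.norm_eq] at this
    have h2 := congrArg (fun t => t ^ 2) this
    simp only at h2
    rw [Real.sq_sqrt (by positivity)] at h2
    simpa using h2
  · intro w z
    have := hA.eigenvectorBasis.sum_inner_mul_inner (WithLp.toLp 2 w) (WithLp.toLp 2 z)
    simp only [EuclideanSpace.inner_eq_star_dotProduct, dotProduct, star_trivial] at this
    rw [show ∑ i, w i * z i = ∑ i, z i * w i from Finset.sum_congr rfl fun i _ => mul_comm _ _]
    rw [← this]
    refine Finset.sum_congr rfl fun k _ => ?_
    congr 1
    · exact Finset.sum_congr rfl fun i _ => mul_comm _ _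
    · exact Finset.sum_congr rfl fun i _ => mul_comm _ _

lemma slc_spectralD {m : ℕ} (Q : Fin m → Fin m → ℝ) (hQ : ∀ i j, Q i j = Q j i)
    (D : Fin m → ℝ) (hD : ∀ i, 0 < D i) :
    ∃ (b : Fin m → Fin m → ℝ) (l : Fin m → ℝ),
      (∀ k i, ∑ j, Q i j * b k j = l k * (D i * b k i)) ∧ (∀ k, ∑ i, D i * b k i ^ 2 = 1) ∧
      (∀ w z : Fin m → ℝ, ∑ k, (∑ i, D i * w i * b k i) * (∑ i, b k i * z i)
        = ∑ i, w i * z i) := by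
  set s : Fin m → ℝ := fun i => Real.sqrt (D i) with hs
  have hs0 : ∀ i, 0 < s i := fun i => Real.sqrt_pos.2 (hD i)
  have hss : ∀ i, D i = s i ^ 2 := fun i => (Real.sq_sqrt (hD i).le).symm
  obtain ⟨b, l, h1, h2, h3⟩ := slc_spectral (fun i j => Q i j / (s i * s j))
    (fun i j => by rw [hQ i j, mul_comm])
  refine ⟨fun k i => b k i / s i, l, ?_, ?_, ?_⟩
  · intro k i
    have h := h1 k i
    have e : ∑ j, Q i j * (b k j / s j) = s i * ∑ j, Q i j / (s i * s j) * b k j := by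
      rw [Finset.mul_sum]
      refine Finset.sum_congr rfl fun j _ => ?_
      have := (hs0 i).ne'
      have := (hs0 j).ne'
      field_simp
    rw [e, h, hss]
    have := (hs0 i).ne'
    field_simp
  · intro k
    rw [← h2 k]
    refine Finset.sum_congr rfl fun i _ => ?_
    have := (hs0 i).ne'
    rw [hss]; field_simp
  · intro w z
    have h := h3 (fun i => s i * w i) (fun i => z i / s i)
    have e : ∑ i, s i * w i * (z i / s i) = ∑ i, w i * z i := by
      refine Finset.sum_congr rfl fun i _ => ?_
      have := (hs0 i).ne'
      field_simp
    rw [← e, ← h]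
    refine Finset.sum_congr rfl fun k _ => ?_
    congr 1
    · refine Finset.sum_congr rfl fun i _ => ?_
      have := (hs0 i).ne'
      rw [hss]; field_simp
    · refine Finset.sum_congr rfl fun i _ => ?_
      ring

lemma slc_trickle {m : ℕ} (Q : Fin m → Fin m → ℝ) (hQ : ∀ i j, Q i j = Q j i)
    (hpos : ∀ i j, 0 < Q i j) (x : Fin m → ℝ) (hx : ∀ i, 0 < x i)
    (h : ∀ v : Fin m → ℝ, ∑ i, v i * ∑ j, Q i j * v j
      ≤ ∑ i, x i * ((∑ j, Q i j * v j) ^ 2 / ∑ j, Q i j * x j))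
    (v : Fin m → ℝ) (hv : ∑ i, v i * ∑ j, Q i j * x j = 0) :
    ∑ i, v i * ∑ j, Q i j * v j ≤ 0 := by
  set D : Fin m → ℝ := fun i => (∑ j, Q i j * x j) / x i with hDdef
  have hQx0 : ∀ i, 0 < ∑ j, Q i j * x j := fun i =>
    Finset.sum_pos (fun j _ => mul_pos (hpos i j) (hx j)) ⟨i, Finset.mem_univ i⟩
  have hD : ∀ i, 0 < D i := fun i => div_pos (hQx0 i) (hx i)
  have hQx : ∀ i, ∑ j, Q i j * x j = D i * x i := fun i => by
    have := (hx i).ne'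
    simp only [hDdef]; field_simp
  obtain ⟨b, l, h1, h2, h3⟩ := slc_spectralD Q hQ D hD
  rw [← h3 v]
  refine Finset.sum_nonpos fun k _ => ?_
  have e1 : ∑ i, b k i * ∑ j, Q i j * v j = l k * ∑ i, D i * v i * b k i := by
    calc ∑ i, b k i * ∑ j, Q i j * v j = ∑ i, ∑ j, b k i * (Q i j * v j) := by
          simp only [Finset.mul_sum]
      _ = ∑ j, ∑ i, b k i * (Q i j * v j) := Finset.sum_comm
      _ = ∑ j, v j * ∑ i, Q j i * b k i := by
          refine Finset.sum_congr rfl fun j _ => ?_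
          rw [Finset.mul_sum]
          refine Finset.sum_congr rfl fun i _ => ?_
          rw [hQ i j]; ring
      _ = _ := by
          rw [Finset.mul_sum]
          refine Finset.sum_congr rfl fun j _ => ?_
          rw [h1]; ring
  rw [e1]
  rcases le_or_gt (l k) 0 with hl | hl
  · nlinarith [sq_nonneg (∑ i, D i * v i * b k i)]
  have hQb : ∑ i, b k i * ∑ j, Q i j * b k j = l k := by
    calc _ = ∑ i, l k * (D i * b k i ^ 2) := by
          refine Finset.sum_congr rfl fun i _ => ?_
          rw [h1]; ring
      _ = l k := by rw [← Finset.mul_sum, h2, mul_one]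
  have hb := h (b k)
  rw [hQb] at hb
  have e2 : ∑ i, x i * ((∑ j, Q i j * b k j) ^ 2 / ∑ j, Q i j * x j) = l k ^ 2 := by
    calc _ = ∑ i, l k ^ 2 * (D i * b k i ^ 2) := by
          refine Finset.sum_congr rfl fun i _ => ?_
          rw [h1, hQx]
          have := (hx i).ne'
          have := (hD i).ne'
          field_simp
      _ = l k ^ 2 := by rw [← Finset.mul_sum, h2, mul_one]
  rw [e2] at hb
  have hl1 : 1 ≤ l k := by nlinarith
  have e3 : ∑ i, ∑ j, Q i j * x i * x j * (b k i / x i - b k j / x j) ^ 2 = 2 * (1 - l k) := by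
    have t : ∀ i j, Q i j * x i * x j * (b k i / x i - b k j / x j) ^ 2
        = (b k i ^ 2 / x i) * (Q i j * x j) + (b k j ^ 2 / x j) * (Q j i * x i)
          - 2 * (b k i * (Q i j * b k j)) := by
      intro i j
      rw [hQ j i]
      have := (hx i).ne'
      have := (hx j).ne'
      field_simp
      ring
    have a1 : ∑ i, ∑ j, (b k i ^ 2 / x i) * (Q i j * x j) = 1 := by
      rw [← h2 k]
      refine Finset.sum_congr rfl fun i _ => ?_
      rw [← Finset.mul_sum, hQx]
      have := (hx i).ne'
      field_simp
    have a2 : ∑ i, ∑ j, (b k j ^ 2 / x j) * (Q j i * x i) = 1 := by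
      rw [Finset.sum_comm]; exact a1
    have a3 : ∑ i, ∑ j, 2 * (b k i * (Q i j * b k j)) = 2 * l k := by
      simp only [← Finset.mul_sum]; rw [hQb]
    simp only [t, Finset.sum_sub_distrib, Finset.sum_add_distrib]
    rw [a1, a2, a3]; ring
  have hnn : ∀ i j, 0 ≤ Q i j * x i * x j * (b k i / x i - b k j / x j) ^ 2 := fun i j =>
    mul_nonneg (mul_nonneg (mul_nonneg (hpos i j).le (hx i).le) (hx j).le) (sq_nonneg _)
  have heq : ∀ i j, b k i / x i = b k j / x j := by
    intro i j
    have z : ∑ i, ∑ j, Q i j * x i * x j * (b k i / x i - b k j / x j) ^ 2 = 0 :=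
      le_antisymm (by rw [e3]; linarith)
        (Finset.sum_nonneg fun i _ => Finset.sum_nonneg fun j _ => hnn i j)
    rw [Finset.sum_eq_zero_iff_of_nonneg
      (fun i _ => Finset.sum_nonneg fun j _ => hnn i j)] at z
    have z1 := z i (Finset.mem_univ i)
    rw [Finset.sum_eq_zero_iff_of_nonneg (fun j _ => hnn i j)] at z1
    have z2 := z1 j (Finset.mem_univ j)
    have : Q i j * x i * x j ≠ 0 := (mul_pos (mul_pos (hpos i j) (hx i)) (hx j)).ne'
    have z3 := (mul_eq_zero.1 z2).resolve_left this
    exact sub_eq_zero.1 (pow_eq_zero_iff (two_ne_zero) |>.1 z3)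
  have hz : ∑ i, D i * v i * b k i = 0 := by
    have : ∀ i, D i * v i * b k i = (b k k / x k) * (v i * ∑ j, Q i j * x j) := by
      intro i
      rw [hQx, ← heq i k]
      have := (hx i).ne'
      field_simp
    simp only [this]
    rw [← Finset.mul_sum, hv, mul_zero]
  rw [hz]; simp

/-- orthogonality form of the signature condition implies the reverse Cauchy–Schwarz inequality -/
lemma slc_reverseCS {m : ℕ} (Q : Fin m → Fin m → ℝ) (hQ : ∀ i j, Q i j = Q j i)
    (x : Fin m → ℝ) (hxx : 0 < ∑ i, x i * ∑ j, Q i j * x j)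
    (h : ∀ v : Fin m → ℝ, ∑ i, v i * ∑ j, Q i j * x j = 0 → ∑ i, v i * ∑ j, Q i j * v j ≤ 0)
    (v : Fin m → ℝ) :
    (∑ i, v i * ∑ j, Q i j * v j) * (∑ i, x i * ∑ j, Q i j * x j)
      ≤ (∑ i, v i * ∑ j, Q i j * x j) ^ 2 := by
  set A := ∑ i, v i * ∑ j, Q i j * v j with hA
  set B := ∑ i, v i * ∑ j, Q i j * x j with hB
  set C := ∑ i, x i * ∑ j, Q i j * x j with hC
  have hB' : ∑ i, x i * ∑ j, Q i j * v j = B := by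
    simp only [hB, Finset.mul_sum]
    rw [Finset.sum_comm]
    refine Finset.sum_congr rfl fun j _ => Finset.sum_congr rfl fun i _ => ?_
    rw [hQ i j]; ring
  have key := h (fun i => v i - B / C * x i) (by
    have : ∀ i, (v i - B / C * x i) * ∑ j, Q i j * x j
      = v i * (∑ j, Q i j * x j) - B / C * (x i * ∑ j, Q i j * x j) := fun i => by ring
    simp only [this, Finset.sum_sub_distrib, ← Finset.mul_sum]
    rw [← hB, ← hC]
    field_simp; ring)
  have e : ∑ i, (v i - B / C * x i) * ∑ j, Q i j * (v j - B / C * x j)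
      = A - 2 * (B / C) * B + (B / C) ^ 2 * C := by
    have i1 : ∀ i, ∑ j, Q i j * (v j - B / C * x j)
        = ∑ j, Q i j * v j - B / C * ∑ j, Q i j * x j := by
      intro i
      rw [Finset.mul_sum, ← Finset.sum_sub_distrib]
      refine Finset.sum_congr rfl fun j _ => by ring
    have i2 : ∀ i, (v i - B / C * x i) * ∑ j, Q i j * (v j - B / C * x j)
        = v i * (∑ j, Q i j * v j) - B / C * (v i * ∑ j, Q i j * x j)
          - B / C * (x i * ∑ j, Q i j * v j) + (B / C) ^ 2 * (x i * ∑ j, Q i j * x j) := by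
      intro i; rw [i1]; ring
    simp only [i2, Finset.sum_sub_distrib, Finset.sum_add_distrib, ← Finset.mul_sum]
    rw [hB', ← hA, ← hB, ← hC]; ring
  simp only [e] at key
  have : (B / C) ^ 2 * C = B ^ 2 / C := by field_simp
  have h3 : A - B ^ 2 / C ≤ 0 := by
    have : A - 2 * (B / C) * B + (B / C) ^ 2 * C = A - B ^ 2 / C := by field_simp; ring
    linarith
  have h4 : A ≤ B ^ 2 / C := by linarith
  exact (le_div_iff₀ hxx).1 h4

/-- base case: rank one minus a nonnegative diagonal matrix -/
lemma slc_base {m : ℕ} (Q : Fin m → Fin m → ℝ) (a : ℝ) (r s : Fin m → ℝ)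
    (ha : 0 < a) (hs : ∀ i, 0 ≤ s i)
    (hQ : ∀ i j, Q i j = a * (r i * r j - if i = j then s i else 0))
    (x : Fin m → ℝ) (hxx : 0 < ∑ i, x i * ∑ j, Q i j * x j)
    (v : Fin m → ℝ) (hv : ∑ i, v i * ∑ j, Q i j * x j = 0) :
    ∑ i, v i * ∑ j, Q i j * v j ≤ 0 := by
  have gen : ∀ y z : Fin m → ℝ, ∑ i, y i * ∑ j, Q i j * z j
      = a * ((∑ i, r i * y i) * (∑ i, r i * z i) - ∑ i, s i * y i * z i) := by
    intro y z
    have i1 : ∀ i, ∑ j, Q i j * z j = a * (r i * ∑ j, r j * z j) - a * (s i * z i) := by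
      intro i
      have : ∀ j, Q i j * z j = a * (r i * (r j * z j)) - if i = j then a * (s i * z j) else 0 := by
        intro j; rw [hQ]; split_ifs <;> ring
      simp only [this, Finset.sum_sub_distrib, ← Finset.mul_sum]
      simp
    simp only [i1]
    have : ∀ i, y i * (a * (r i * ∑ j, r j * z j) - a * (s i * z i))
      = (a * ∑ j, r j * z j) * (r i * y i) - a * (s i * y i * z i) := fun i => by ring
    simp only [this, Finset.sum_sub_distrib, ← Finset.mul_sum]
    ring
  rw [gen] at hxx hv ⊢
  set B := ∑ i, r i * x i
  set A := ∑ i, r i * v i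
  have hxx' : ∑ i, s i * x i * x i < B * B := by
    have := (mul_pos_iff_of_pos_left ha).1 hxx; linarith
  have hv' : A * B = ∑ i, s i * v i * x i := by
    have := (mul_eq_zero.1 hv).resolve_left ha.ne'; linarith
  have cs : (∑ i, s i * v i * x i) ^ 2 ≤ (∑ i, s i * v i * v i) * (∑ i, s i * x i * x i) := by
    have := Finset.sum_mul_sq_le_sq_mul_sq Finset.univ (fun i => Real.sqrt (s i) * v i)
      (fun i => Real.sqrt (s i) * x i)
    have e : ∀ y z : Fin m → ℝ, ∀ i, Real.sqrt (s i) * y i * (Real.sqrt (s i) * z i)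
        = s i * y i * z i := by
      intro y z i
      have := Real.mul_self_sqrt (hs i)
      calc _ = (Real.sqrt (s i) * Real.sqrt (s i)) * y i * z i := by ring
        _ = _ := by rw [this]
    simpa only [e, pow_two] using (by simpa only [pow_two, e] using this)
  have hx0 : 0 ≤ ∑ i, s i * x i * x i :=
    Finset.sum_nonneg fun i _ => by have := hs i; nlinarith [mul_nonneg this (mul_self_nonneg (x i))]
  have hv0 : 0 ≤ ∑ i, s i * v i * v i :=
    Finset.sum_nonneg fun i _ => by have := hs i; nlinarith [mul_nonneg this (mul_self_nonneg (v i))]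
  have hfin : A * A ≤ ∑ i, s i * v i * v i := by
    by_contra hcon
    push Not at hcon
    rw [← hv'] at cs
    nlinarith [mul_le_mul_of_nonneg_left hxx'.le hv0, mul_pos (sub_pos.2 hcon) (lt_of_le_of_lt hx0 hxx')]
  nlinarith

end LinAlg

section Induct

lemma slc_sum_single {m : ℕ} (β : Fin m → ℕ) (i : Fin m) :
    ∑ k, (β + (Pi.single i 1 : Fin m → ℕ)) k = ∑ k, β k + 1 := by
  simp [Finset.sum_add_distrib]

lemma slc_induct {m d : ℕ} [Nonempty (Fin m)] (P : (Fin m → ℕ) → ℝ) (x : Fin m → ℝ)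
    (hx : ∀ i, 0 < x i)
    (hpos : ∀ β, ∑ k, β k ≤ d → 0 < P β)
    (euler : ∀ β : Fin m → ℕ, ∀ r : ℕ, ∑ k, β k + r = d →
      ∑ i, P (β + Pi.single i 1) * x i = r * P β)
    (base : ∀ β : Fin m → ℕ, ∑ k, β k + 2 = d → ∃ (a : ℝ) (r s : Fin m → ℝ), 0 < a ∧
      (∀ i, 0 ≤ s i) ∧ ∀ i j, P (β + Pi.single i 1 + Pi.single j 1)
        = a * (r i * r j - if i = j then s i else 0)) :
    ∀ (r : ℕ) (β : Fin m → ℕ), ∑ k, β k + (r + 2) = d → ∀ v : Fin m → ℝ,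
      ((r : ℝ) + 2) * P β * (∑ i, v i * ∑ j, P (β + Pi.single i 1 + Pi.single j 1) * v j)
        ≤ ((r : ℝ) + 1) * (∑ i, v i * P (β + Pi.single i 1)) ^ 2 := by
  have red : ∀ (r : ℕ) (β : Fin m → ℕ), ∑ k, β k + (r + 2) = d →
      ((0 < ∑ i, x i * ∑ j, P (β + Pi.single i 1 + Pi.single j 1) * x j) →
      ∀ v : Fin m → ℝ, ∑ i, v i * ∑ j, P (β + Pi.single i 1 + Pi.single j 1) * x j = 0 →
        ∑ i, v i * ∑ j, P (β + Pi.single i 1 + Pi.single j 1) * v j ≤ 0) →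
      ∀ v : Fin m → ℝ,
      ((r : ℝ) + 2) * P β * (∑ i, v i * ∑ j, P (β + Pi.single i 1 + Pi.single j 1) * v j)
        ≤ ((r : ℝ) + 1) * (∑ i, v i * P (β + Pi.single i 1)) ^ 2 := by
    intro r β hβ h v
    have e1 : ∀ i, ∑ j, P (β + Pi.single i 1 + Pi.single j 1) * x j
        = ((r : ℝ) + 1) * P (β + Pi.single i 1) := by
      intro i
      rw [euler _ (r + 1) (by rw [slc_sum_single]; omega)]
      push_cast; ring
    have e2 : ∀ w : Fin m → ℝ, ∑ i, w i * ∑ j, P (β + Pi.single i 1 + Pi.single j 1) * x j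
        = ((r : ℝ) + 1) * ∑ i, w i * P (β + Pi.single i 1) := by
      intro w
      rw [Finset.mul_sum]
      refine Finset.sum_congr rfl fun i _ => ?_
      rw [e1]; ring
    have e3 : ∑ i, x i * ∑ j, P (β + Pi.single i 1 + Pi.single j 1) * x j
        = ((r : ℝ) + 1) * (((r : ℝ) + 2) * P β) := by
      rw [e2]
      congr 1
      rw [← (show ((r + 2 : ℕ) : ℝ) = (r : ℝ) + 2 by push_cast; ring), ← euler β (r + 2) hβ]
      exact Finset.sum_congr rfl fun i _ => mul_comm _ _
    have hp : 0 < P β := hpos β (by omega)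
    have hxx : 0 < ∑ i, x i * ∑ j, P (β + Pi.single i 1 + Pi.single j 1) * x j := by
      rw [e3]; positivity
    have := slc_reverseCS (fun i j => P (β + Pi.single i 1 + Pi.single j 1))
      (fun i j => by rw [add_right_comm]) x hxx (h hxx) v
    rw [e3, e2] at this
    have hr : (0 : ℝ) < (r : ℝ) + 1 := by positivity
    refine le_of_mul_le_mul_left ?_ hr
    nlinarith [this]
  intro r
  induction r with
  | zero =>
    intro β hβ
    refine red 0 β hβ ?_
    intro hxx v hv
    obtain ⟨a, r, s, ha, hs, hP⟩ := base β (by omega)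
    exact slc_base (fun i j => P (β + Pi.single i 1 + Pi.single j 1)) a r s ha hs hP x hxx v hv
  | succ r ih =>
    intro β hβ
    refine red (r + 1) β hβ ?_
    intro _ v hv
    refine slc_trickle (fun i j => P (β + Pi.single i 1 + Pi.single j 1))
      (fun i j => by rw [add_right_comm]) (fun i j => hpos _ (by
        rw [slc_sum_single, slc_sum_single]; omega)) x hx ?_ v hv
    clear v hv
    intro v
    have hr : (0 : ℝ) < (r : ℝ) + 1 := by positivity
    have hG : ∀ i, 0 < P (β + Pi.single i 1) := fun i => hpos _ (by rw [slc_sum_single]; omega)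
    have e1 : ∀ i, ∑ j, P (β + Pi.single i 1 + Pi.single j 1) * x j
        = ((r : ℝ) + 2) * P (β + Pi.single i 1) := by
      intro i
      rw [euler _ (r + 2) (by rw [slc_sum_single]; omega)]
      push_cast; ring
    have e2 : ∑ i, x i * ∑ j, v j * ∑ k,
        P (β + Pi.single i 1 + Pi.single j 1 + Pi.single k 1) * v k
        = ((r : ℝ) + 1) * ∑ j, v j * ∑ k, P (β + Pi.single j 1 + Pi.single k 1) * v k := by
      simp only [Finset.mul_sum]
      rw [Finset.sum_comm]
      refine Finset.sum_congr rfl fun j _ => ?_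
      rw [Finset.sum_comm]
      refine Finset.sum_congr rfl fun k _ => ?_
      have := euler (β + Pi.single j 1 + Pi.single k 1) (r + 1)
        (by rw [slc_sum_single, slc_sum_single]; omega)
      calc _ = (∑ i, P (β + Pi.single j 1 + Pi.single k 1 + Pi.single i 1) * x i) * (v j * v k) := by
            rw [Finset.sum_mul]
            refine Finset.sum_congr rfl fun i _ => ?_
            rw [show β + Pi.single i 1 + Pi.single j 1 + Pi.single k 1
              = β + Pi.single j 1 + Pi.single k 1 + Pi.single i 1 by abel]
            ring
        _ = _ := by rw [this]; push_cast; ring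
    refine le_of_mul_le_mul_left ?_ hr
    rw [← e2, Finset.mul_sum]
    refine Finset.sum_le_sum fun i _ => ?_
    have h := ih (β + Pi.single i 1) (by rw [slc_sum_single]; omega) v
    rw [e1]
    have hsw : ∑ j, v j * P (β + Pi.single i 1 + Pi.single j 1)
      = ∑ j, P (β + Pi.single i 1 + Pi.single j 1) * v j :=
      Finset.sum_congr rfl fun j _ => mul_comm _ _
    rw [hsw] at h
    have h2 : 0 < ((r : ℝ) + 2) * P (β + Pi.single i 1) := mul_pos (by positivity) (hG i)
    calc x i * ∑ j, v j * ∑ k, P (β + Pi.single i 1 + Pi.single j 1 + Pi.single k 1) * v k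
        ≤ x i * (((r : ℝ) + 1) * (∑ j, P (β + Pi.single i 1 + Pi.single j 1) * v j) ^ 2
          / (((r : ℝ) + 2) * P (β + Pi.single i 1))) := by
          refine mul_le_mul_of_nonneg_left ?_ (hx i).le
          rw [le_div_iff₀ h2]
          linarith
      _ = _ := by ring

end Induct

section Poly

/-- `∂^β` of the weighted homogeneous polynomial with weights `W`. -/
noncomputable def slcPoly {m : ℕ} (A : ℝ) (W : Fin m → ℕ → ℝ) (d : ℕ) (β : Fin m → ℕ) :
    MvPolynomial (Fin m) ℝ :=
  ∑ α ∈ (Fintype.piFinset fun _ : Fin m => Finset.range (d + 1)).filter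
      (fun α => ∑ j, α j + ∑ j, β j = d),
    MvPolynomial.monomial (Finsupp.equivFunOnFinite.symm α)
      (A * ∏ j, W j (α j + β j) / ((α j).factorial : ℝ))

lemma slcPoly_coeff {m : ℕ} (A : ℝ) (W : Fin m → ℕ → ℝ) (d : ℕ) (β : Fin m → ℕ)
    (γ : Fin m →₀ ℕ) : MvPolynomial.coeff γ (slcPoly A W d β)
      = if ∑ j, γ j + ∑ j, β j = d then A * ∏ j, W j (γ j + β j) / ((γ j).factorial : ℝ)
        else 0 := by
  classical
  unfold slcPoly
  rw [MvPolynomial.coeff_sum]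
  simp only [MvPolynomial.coeff_monomial]
  have : ∀ α : Fin m → ℕ, (Finsupp.equivFunOnFinite.symm α = γ) ↔ (α = ⇑γ) := by
    intro α
    rw [Equiv.symm_apply_eq]; rfl
  simp only [this]
  rw [Finset.sum_ite_eq']
  congr 1
  simp only [Finset.mem_filter, Fintype.mem_piFinset, Finset.mem_range, eq_iff_iff,
    and_iff_right_iff_imp]
  intro h j
  have := Finset.single_le_sum (f := fun j => γ j) (fun _ _ => Nat.zero_le _) (Finset.mem_univ j)
  omega

lemma slcPoly_pderiv {m : ℕ} (A : ℝ) (W : Fin m → ℕ → ℝ) (d : ℕ) (β : Fin m → ℕ) (i : Fin m) :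
    MvPolynomial.pderiv i (slcPoly A W d β) = slcPoly A W d (β + Pi.single i 1) := by
  classical
  ext γ
  rw [MvPolynomial.coeff_pderiv, slcPoly_coeff, slcPoly_coeff, slc_sum_single]
  have : ∑ j, (γ + (Finsupp.single i 1 : Fin m →₀ ℕ)) j = ∑ j, γ j + 1 := by
    simp [Finset.sum_add_distrib, Finsupp.single_apply]
  rw [this]
  have hc : (∑ j, γ j + 1 + ∑ j, β j = d) ↔ (∑ j, γ j + (∑ j, β j + 1) = d) := by omega
  simp only [hc]
  split_ifs
  · rw [mul_assoc]
    congr 1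
    rw [← Finset.mul_prod_erase _ _ (Finset.mem_univ i), ← Finset.mul_prod_erase _ _ (Finset.mem_univ i)]
    rw [mul_right_comm]
    congr 1
    · simp only [Finsupp.add_apply, Finsupp.single_eq_same, Pi.add_apply, Pi.single_eq_same,
        Nat.factorial_succ]
      have : ((γ i).factorial : ℝ) ≠ 0 := by positivity
      rw [show γ i + 1 + β i = γ i + (β i + 1) by ring]
      push_cast
      field_simp
    · refine Finset.prod_congr rfl fun j hj => ?_
      have := Finset.ne_of_mem_erase hj
      simp [Finsupp.single_apply, Pi.single_apply, this, this.symm]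
  · simp

lemma slcPoly_iter {m : ℕ} (A : ℝ) (W : Fin m → ℕ → ℝ) (d : ℕ) (i : Fin m) (n : ℕ) :
    ∀ β : Fin m → ℕ, (fun r => MvPolynomial.pderiv i r)^[n] (slcPoly A W d β)
      = slcPoly A W d (β + Pi.single i n) := by
  induction n with
  | zero => intro β; simp
  | succ n ih =>
    intro β
    rw [Function.iterate_succ_apply, slcPoly_pderiv, ih, add_assoc, ← Pi.single_add, add_comm 1 n]

lemma slcPoly_multi {m : ℕ} (A : ℝ) (W : Fin m → ℕ → ℝ) (d : ℕ) (β : Fin m → ℕ) :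
    pderivMulti β (slcPoly A W d 0) = slcPoly A W d β := by
  have gen : ∀ l : List (Fin m),
      l.foldr (fun j acc => (fun r => MvPolynomial.pderiv j r)^[β j] acc) (slcPoly A W d 0)
        = slcPoly A W d ((l.map fun j => Pi.single j (β j)).sum) := by
    intro l
    induction l with
    | nil => simp
    | cons j l ih =>
      rw [List.foldr_cons, ih, slcPoly_iter, List.map_cons, List.sum_cons, add_comm]
  unfold pderivMulti
  rw [gen]
  congr 1
  rw [← List.ofFn_eq_map, List.sum_ofFn]
  exact Finset.univ_sum_single β

lemma slcPoly_eval {m : ℕ} (A : ℝ) (W : Fin m → ℕ → ℝ) (d : ℕ) (β : Fin m → ℕ) (x : Fin m → ℝ) :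
    MvPolynomial.eval x (slcPoly A W d β)
      = ∑ α ∈ (Fintype.piFinset fun _ : Fin m => Finset.range (d + 1)).filter
      (fun α => ∑ j, α j + ∑ j, β j = d),
        (A * ∏ j, W j (α j + β j) / ((α j).factorial : ℝ)) * ∏ j, x j ^ α j := by
  unfold slcPoly
  rw [map_sum]
  refine Finset.sum_congr rfl fun α _ => ?_
  rw [MvPolynomial.eval_monomial, Finsupp.prod_fintype _ _ (by simp)]
  rfl

lemma slcPoly_euler {m : ℕ} (A : ℝ) (W : Fin m → ℕ → ℝ) (d : ℕ) (β : Fin m → ℕ) (x : Fin m → ℝ)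
    (r : ℕ) (hr : ∑ k, β k + r = d) :
    ∑ i, MvPolynomial.eval x (slcPoly A W d (β + Pi.single i 1)) * x i
      = r * MvPolynomial.eval x (slcPoly A W d β) := by
  have hh : (slcPoly A W d β).IsHomogeneous r := by
    intro γ hγ
    rw [slcPoly_coeff] at hγ
    have : ∑ j, γ j + ∑ j, β j = d := by
      by_contra h; simp [h] at hγ
    rw [Finsupp.weight_apply, Finsupp.sum_fintype _ _ (by simp)]
    simp
    omega
  have := congrArg (MvPolynomial.eval x) hh.sum_X_mul_pderiv
  simp only [map_sum, map_mul, MvPolynomial.eval_X, map_nsmul, slcPoly_pderiv, nsmul_eq_mul,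
    map_natCast] at this
  rw [← this]
  exact Finset.sum_congr rfl fun i _ => mul_comm _ _

lemma slcPoly_pos {m : ℕ} [Nonempty (Fin m)] (A : ℝ) (hA : 0 < A) (W : Fin m → ℕ → ℝ)
    (hW : ∀ j t, 0 < W j t) (d : ℕ) (β : Fin m → ℕ) (x : Fin m → ℝ)
    (hx : ∀ i, 0 < x i) (hβ : ∑ k, β k ≤ d) :
    0 < MvPolynomial.eval x (slcPoly A W d β) := by
  rw [slcPoly_eval]
  refine Finset.sum_pos (fun α _ => ?_) ?_
  · refine mul_pos (mul_pos hA (Finset.prod_pos fun j _ => div_pos (hW _ _) (by positivity)))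
      (Finset.prod_pos fun j _ => pow_pos (hx j) _)
  · let j0 : Fin m := Classical.arbitrary _
    refine ⟨Pi.single j0 (d - ∑ k, β k), ?_⟩
    simp only [Finset.mem_filter, Fintype.mem_piFinset, Finset.mem_range]
    constructor
    · intro j
      by_cases h : j = j0
      · subst h; simp
      · simp [Pi.single_apply, h]
    · simp; omega

lemma slcPoly_top {m : ℕ} (A : ℝ) (W : Fin m → ℕ → ℝ) (d : ℕ) (β : Fin m → ℕ) (x : Fin m → ℝ)
    (hβ : ∑ k, β k = d) :
    MvPolynomial.eval x (slcPoly A W d β) = A * ∏ j, W j (β j) := by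
  rw [slcPoly_eval, Finset.sum_eq_single 0]
  · simp
  · intro α hα h0
    exfalso
    apply h0
    simp only [Finset.mem_filter] at hα
    have : ∑ j, α j = 0 := by omega
    rw [Finset.sum_eq_zero_iff] at this
    funext j
    exact this j (Finset.mem_univ j)
  · intro h
    exfalso; apply h
    simp [hβ]

lemma slcPoly_base {m : ℕ} (A : ℝ) (hA : 0 < A) (W : Fin m → ℕ → ℝ)
    (hW : ∀ j t, 0 < W j t) (hlc : ∀ j t, W j t * W j (t + 2) ≤ W j (t + 1) ^ 2)
    (d : ℕ) (β : Fin m → ℕ) (x : Fin m → ℝ) (hβ : ∑ k, β k + 2 = d) :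
    ∃ (a : ℝ) (r s : Fin m → ℝ), 0 < a ∧
      (∀ i, 0 ≤ s i) ∧ ∀ i j,
        MvPolynomial.eval x (slcPoly A W d (β + Pi.single i 1 + Pi.single j 1))
        = a * (r i * r j - if i = j then s i else 0) := by
  classical
  refine ⟨A * ∏ j, W j (β j), fun i => W i (β i + 1) / W i (β i),
    fun i => (W i (β i + 1) / W i (β i)) ^ 2 - W i (β i + 2) / W i (β i),
    mul_pos hA (Finset.prod_pos fun j _ => hW _ _), ?_, ?_⟩
  · intro i
    have h := hlc i (β i)
    have h0 := hW i (β i)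
    rw [sub_nonneg, div_pow, div_le_div_iff₀ h0 (by positivity)]
    nlinarith
  · intro i j
    rw [slcPoly_top _ _ _ _ _ (by rw [slc_sum_single, slc_sum_single]; omega), mul_assoc]
    congr 1
    have hi := (hW i (β i)).ne'
    have hj := (hW j (β j)).ne'
    rw [← Finset.mul_prod_erase _ _ (Finset.mem_univ i),
      ← Finset.mul_prod_erase _ (fun k => W k (β k)) (Finset.mem_univ i)]
    by_cases hij : i = j
    · subst hij
      have : ∏ k ∈ Finset.univ.erase i, W k ((β + (Pi.single i 1 : Fin m → ℕ) + (Pi.single i 1 : Fin m → ℕ)) k)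
          = ∏ k ∈ Finset.univ.erase i, W k (β k) := by
        refine Finset.prod_congr rfl fun k hk => ?_
        have := Finset.ne_of_mem_erase hk
        simp [Pi.single_apply, this]
      rw [this]
      simp only [Pi.add_apply, Pi.single_eq_same, if_true, add_assoc]
      norm_num
      field_simp
      ring
    · have hj' : j ∈ Finset.univ.erase i := by simp [Ne.symm hij]
      rw [← Finset.mul_prod_erase _ _ hj', ← Finset.mul_prod_erase _ (fun k => W k (β k)) hj']
      have : ∏ k ∈ (Finset.univ.erase i).erase j, W k ((β + (Pi.single i 1 : Fin m → ℕ) + (Pi.single j 1 : Fin m → ℕ)) k)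
          = ∏ k ∈ (Finset.univ.erase i).erase j, W k (β k) := by
        refine Finset.prod_congr rfl fun k hk => ?_
        have h1 := Finset.ne_of_mem_erase hk
        have h2 := Finset.ne_of_mem_erase (Finset.mem_of_mem_erase hk)
        simp [Pi.single_apply, h1, h2]
      rw [this]
      simp only [Pi.add_apply, Pi.single_eq_same, if_neg hij]
      rw [Pi.single_eq_of_ne hij, Pi.single_eq_of_ne (Ne.symm hij)]
      simp only [add_zero, sub_zero]
      field_simp

/-- log-concavity at positive points for positive log-concave weights. -/
lemma slcPoly_lc {m : ℕ} (A : ℝ) (hA : 0 < A) (W : Fin m → ℕ → ℝ)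
    (hW : ∀ j t, 0 < W j t) (hlc : ∀ j t, W j t * W j (t + 2) ≤ W j (t + 1) ^ 2)
    (d : ℕ) (β : Fin m → ℕ) (x : Fin m → ℝ) (hx : ∀ i, 0 < x i) (v : Fin m → ℝ) :
    MvPolynomial.eval x (slcPoly A W d β) * (∑ i, v i * ∑ j,
        MvPolynomial.eval x (slcPoly A W d (β + Pi.single i 1 + Pi.single j 1)) * v j)
      ≤ (∑ i, v i * MvPolynomial.eval x (slcPoly A W d (β + Pi.single i 1))) ^ 2 := by
  rcases isEmpty_or_nonempty (Fin m) with hm | hm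
  · simp
  by_cases hd : ∑ k, β k + 2 ≤ d
  · obtain ⟨r, hr⟩ := Nat.exists_eq_add_of_le hd
    have := slc_induct (d := d) (fun β => MvPolynomial.eval x (slcPoly A W d β)) x hx
      (fun β hβ => slcPoly_pos A hA W hW d β x hx hβ)
      (fun β r hr => slcPoly_euler A W d β x r hr)
      (fun β hβ => slcPoly_base A hA W hW hlc d β x hβ) r β (by omega) v
    have hr0 : (0 : ℝ) ≤ r := Nat.cast_nonneg r
    set p := MvPolynomial.eval x (slcPoly A W d β) * (∑ i, v i * ∑ j,
        MvPolynomial.eval x (slcPoly A W d (β + Pi.single i 1 + Pi.single j 1)) * v j) with hp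
    rw [mul_assoc, ← hp] at this
    set g := (∑ i, v i * MvPolynomial.eval x (slcPoly A W d (β + Pi.single i 1)))
    nlinarith [sq_nonneg g]
  · have : ∀ i j, MvPolynomial.eval x (slcPoly A W d (β + Pi.single i 1 + Pi.single j 1)) = 0 := by
      intro i j
      rw [slcPoly_eval]
      refine Finset.sum_eq_zero fun α hα => ?_
      exfalso
      rw [Finset.mem_filter, slc_sum_single, slc_sum_single] at hα
      omega
    simp only [this]
    simp
    positivity

end Poly

section Weights

/-- perturbed weights: positive for `ε > 0`, and truncated at the capacity for `ε = 0`. -/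
noncomputable def slcW {m : ℕ} (u : Fin m → ℕ) (c : Fin m → ℕ → ℝ) (a T ε : ℝ)
    (j : Fin m) (t : ℕ) : ℝ :=
  Real.exp (-a * ((t : ℝ) * ((t : ℝ) - 1)) + -T * ∑ s ∈ Finset.Icc 1 t, c j s) * ε ^ (t - u j)

lemma slcW_pos {m : ℕ} (u : Fin m → ℕ) (c : Fin m → ℕ → ℝ) (a T ε : ℝ) (hε : 0 < ε)
    (j : Fin m) (t : ℕ) : 0 < slcW u c a T ε j t :=
  mul_pos (Real.exp_pos _) (pow_pos hε _)

lemma slcW_lc {m : ℕ} (u : Fin m → ℕ) (c : Fin m → ℕ → ℝ)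
    (hc : ∀ j, ∀ t, 1 ≤ t → c j t ≤ c j (t + 1)) (a T ε : ℝ) (ha : 0 ≤ a) (hT : 0 ≤ T)
    (hε : 0 < ε) (hε1 : ε ≤ 1) (j : Fin m) (t : ℕ) :
    slcW u c a T ε j t * slcW u c a T ε j (t + 2) ≤ slcW u c a T ε j (t + 1) ^ 2 := by
  unfold slcW
  rw [mul_mul_mul_comm, mul_pow, ← Real.exp_add, ← pow_add, ← Real.exp_nat_mul, ← pow_mul]
  refine mul_le_mul ?_ ?_ (by positivity) (by positivity)
  · rw [Real.exp_le_exp]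
    rw [Finset.sum_Icc_succ_top (by omega : 1 ≤ t + 1 + 1), Finset.sum_Icc_succ_top (by omega : 1 ≤ t + 1)]
    have := mul_le_mul_of_nonneg_left (hc j (t + 1) (by omega)) hT
    push_cast
    nlinarith
  · exact pow_le_pow_of_le_one hε.le hε1 (by omega)

lemma slc_poly_eq {m : ℕ} (u : Fin m → ℕ) (c : Fin m → ℕ → ℝ) (a T : ℝ) (K : ℕ) (B : ℕ) :
    (∑ α ∈ feasibleLoads u K,
        MvPolynomial.monomial (Finsupp.equivFunOnFinite.symm α)
          ((Nat.factorial K : ℝ)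
              / ((B : ℕ) * (∏ j, Nat.factorial (α j) : ℕ))
            * Real.exp (-a * ∑ j, (α j : ℝ) * ((α j : ℝ) - 1))
            * Real.exp (-T * rosenthalLoad c α)))
      = slcPoly ((Nat.factorial K : ℝ) / (B : ℝ)) (slcW u c a T 0) K 0 := by
  have hsub : feasibleLoads u K ⊆ (Fintype.piFinset fun _ : Fin m => Finset.range (K + 1)).filter
      (fun α => ∑ j, α j + ∑ j, (0 : Fin m → ℕ) j = K) := by
    intro α hα
    simp only [feasibleLoads, Finset.mem_filter, Fintype.mem_piFinset, Finset.mem_range] at hα ⊢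
    refine ⟨fun j => ?_, by simpa using hα.2⟩
    have := Finset.single_le_sum (f := α) (fun _ _ => Nat.zero_le _) (Finset.mem_univ j)
    omega
  unfold slcPoly
  rw [← Finset.sum_subset hsub]
  · refine Finset.sum_congr rfl fun α hα => ?_
    simp only [feasibleLoads, Finset.mem_filter, Fintype.mem_piFinset, Finset.mem_range] at hα
    congr 1
    have : ∀ j, slcW u c a T 0 j (α j + (0 : Fin m → ℕ) j)
        = Real.exp (-a * ((α j : ℝ) * ((α j : ℝ) - 1)) + -T * ∑ s ∈ Finset.Icc 1 (α j), c j s) := by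
      intro j
      have h := hα.1 j
      unfold slcW
      rw [show α j + (0 : Fin m → ℕ) j = α j from rfl, show α j - u j = 0 by omega]
      simp
    simp only [this]
    rw [Finset.prod_div_distrib, ← Real.exp_sum, Finset.sum_add_distrib, ← Finset.mul_sum,
      ← Finset.mul_sum, Real.exp_add]
    unfold rosenthalLoad
    push_cast
    rw [← div_div]
    ring
  · intro α hα hα'
    simp only [feasibleLoads, Finset.mem_filter, Fintype.mem_piFinset, Finset.mem_range] at hα hα'
    have hs : ∑ j, α j = K := by simpa using hα.2
    have : ∃ j, u j < α j := by
      by_contra hcon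
      push Not at hcon
      exact hα' ⟨fun j => by have := hcon j; omega, hs⟩
    obtain ⟨j, hj⟩ := this
    rw [Finset.prod_eq_zero (Finset.mem_univ j)]
    · simp
    · unfold slcW
      rw [show α j + (0 : Fin m → ℕ) j = α j from rfl, zero_pow (by omega)]
      simp

lemma slc_cont {m : ℕ} (A : ℝ) (u : Fin m → ℕ) (c : Fin m → ℕ → ℝ) (a T : ℝ) (K : ℕ)
    (β : Fin m → ℕ) (x : Fin m → ℝ) :
    Continuous fun ε : ℝ =>
      MvPolynomial.eval (fun i => x i + ε) (slcPoly A (slcW u c a T ε) K β) := by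
  simp only [slcPoly_eval, slcW]
  fun_prop

lemma slc_limit {m : ℕ} (A : ℝ) (hA : 0 < A) (u : Fin m → ℕ) (c : Fin m → ℕ → ℝ)
    (hc : ∀ j, ∀ t, 1 ≤ t → c j t ≤ c j (t + 1)) (a : ℝ) (ha : 0 ≤ a) (T : ℝ) (hT : 0 ≤ T)
    (d : ℕ) (β : Fin m → ℕ) (x : Fin m → ℝ) (hx : ∀ i, 0 ≤ x i) (v : Fin m → ℝ) :
    MvPolynomial.eval x (slcPoly A (slcW u c a T 0) d β) * (∑ i, v i * ∑ j,
        MvPolynomial.eval x (slcPoly A (slcW u c a T 0) d (β + Pi.single i 1 + Pi.single j 1)) * v j)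
      ≤ (∑ i, v i * MvPolynomial.eval x (slcPoly A (slcW u c a T 0) d (β + Pi.single i 1))) ^ 2 := by
  let F : ℝ → (Fin m → ℕ) → ℝ := fun ε γ =>
    MvPolynomial.eval (fun i => x i + ε) (slcPoly A (slcW u c a T ε) d γ)
  have hF : ∀ γ, Continuous fun ε => F ε γ := fun γ => slc_cont A u c a T d γ x
  have hF0 : ∀ γ, F 0 γ = MvPolynomial.eval x (slcPoly A (slcW u c a T 0) d γ) := by
    intro γ; simp only [F, add_zero]
  simp only [← hF0]
  have c1 : Continuous fun ε => F ε β * (∑ i, v i * ∑ j,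
        F ε (β + Pi.single i 1 + Pi.single j 1) * v j) := by
    refine (hF _).mul (continuous_finsetSum _ fun i _ => continuous_const.mul
      (continuous_finsetSum _ fun j _ => (hF _).mul continuous_const))
  have c2 : Continuous fun ε => (∑ i, v i * F ε (β + Pi.single i 1)) ^ 2 := by
    refine (continuous_finsetSum _ fun i _ => continuous_const.mul (hF _)).pow 2
  have t1 := (c1.tendsto 0).mono_left (nhdsWithin_le_nhds (s := Set.Ioi 0))
  have t2 := (c2.tendsto 0).mono_left (nhdsWithin_le_nhds (s := Set.Ioi 0))
  refine le_of_tendsto_of_tendsto t1 t2 ?_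
  filter_upwards [Ioo_mem_nhdsGT (show (0 : ℝ) < 1 by norm_num)] with ε hε
  exact slcPoly_lc A hA (slcW u c a T ε) (slcW_pos u c a T ε hε.1)
    (slcW_lc u c hc a T ε ha hT hε.1 hε.2.le) d β (fun i => x i + ε)
    (fun i => add_pos_of_nonneg_of_pos (hx i) hε.1) v

end Weights

/-- for `k ∈ ℕ^n` with `K = Σ_i k_i ≥ 1`, `K₂ = Σ_i k_i(k_i−1)`, capacities
`u ∈ ℕ^m` with `L(k,u) ≠ ∅`, non-decreasing cost functions `c_j`, and `T ≥ 0`, the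
`K`-homogeneous generating polynomial
`g(x) = Σ_{α ∈ L(k,u)} (K!/(k!·α!))·exp(−(K₂/K²)·Σ_j α_j(α_j−1))·exp(−T·Φ̄(α))·x^α`
is strongly log-concave. -/
theorem slc_capacitated_uniform {n m : ℕ} (k : Fin n → ℕ) (u : Fin m → ℕ)
    (hK : 1 ≤ ∑ i, k i)
    (hne : (feasibleLoads u (∑ i, k i)).Nonempty)
    (c : Fin m → ℕ → ℝ) (hc : ∀ j, ∀ t, 1 ≤ t → c j t ≤ c j (t + 1))
    (T : ℝ) (hT : 0 ≤ T) :
    StronglyLogConcave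
      (∑ α ∈ feasibleLoads u (∑ i, k i),
        MvPolynomial.monomial (Finsupp.equivFunOnFinite.symm α)
          ((Nat.factorial (∑ i, k i) : ℝ)
              / ((∏ i, Nat.factorial (k i) : ℕ) * (∏ j, Nat.factorial (α j) : ℕ))
            * Real.exp (-((∑ i, (k i : ℝ) * ((k i : ℝ) - 1)) / ((∑ i, k i : ℕ) : ℝ) ^ 2)
                * ∑ j, (α j : ℝ) * ((α j : ℝ) - 1))
            * Real.exp (-T * rosenthalLoad c α))) := by
  set K := ∑ i, k i with hKdef
  set a : ℝ := (∑ i, (k i : ℝ) * ((k i : ℝ) - 1)) / ((K : ℕ) : ℝ) ^ 2 with hadef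
  have ha : 0 ≤ a := by
    refine div_nonneg (Finset.sum_nonneg fun i _ => ?_) (by positivity)
    rcases Nat.eq_zero_or_pos (k i) with h | h
    · simp [h]
    · have : (1 : ℝ) ≤ k i := by exact_mod_cast h
      nlinarith
  set A : ℝ := (Nat.factorial K : ℝ) / ((∏ i, Nat.factorial (k i) : ℕ) : ℝ) with hAdef
  have hA : 0 < A := by
    refine div_pos (by positivity) ?_
    exact_mod_cast Finset.prod_pos fun i _ => Nat.factorial_pos (k i)
  have hpoly : (∑ α ∈ feasibleLoads u K,
        MvPolynomial.monomial (Finsupp.equivFunOnFinite.symm α)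
          ((Nat.factorial K : ℝ)
              / ((∏ i, Nat.factorial (k i) : ℕ) * (∏ j, Nat.factorial (α j) : ℕ))
            * Real.exp (-a * ∑ j, (α j : ℝ) * ((α j : ℝ) - 1))
            * Real.exp (-T * rosenthalLoad c α))) = slcPoly A (slcW u c a T 0) K 0 :=
    slc_poly_eq u c a T K _
  rw [hpoly]
  intro β x hx _
  simp only [slcPoly_multi, slcPoly_pderiv]
  refine Matrix.PosSemidef.of_dotProduct_mulVec_nonneg ?_ ?_
  · ext i j
    simp only [Matrix.conjTranspose_apply, Matrix.neg_apply, Matrix.of_apply, star_trivial]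
    rw [add_right_comm, mul_comm (MvPolynomial.eval x (slcPoly A _ K (β + Pi.single j 1)))]
  · intro v
    have h := slc_limit A hA u c hc a ha T hT K β x hx v
    have e : star v ⬝ᵥ (-(Matrix.of fun i j : Fin m =>
        MvPolynomial.eval x (slcPoly A (slcW u c a T 0) K β)
            * MvPolynomial.eval x (slcPoly A (slcW u c a T 0) K (β + Pi.single j 1 + Pi.single i 1))
          - MvPolynomial.eval x (slcPoly A (slcW u c a T 0) K (β + Pi.single i 1))
            * MvPolynomial.eval x (slcPoly A (slcW u c a T 0) K (β + Pi.single j 1)))).mulVec v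
        = (∑ i, v i * MvPolynomial.eval x (slcPoly A (slcW u c a T 0) K (β + Pi.single i 1))) ^ 2
          - MvPolynomial.eval x (slcPoly A (slcW u c a T 0) K β) * (∑ i, v i * ∑ j,
        MvPolynomial.eval x (slcPoly A (slcW u c a T 0) K (β + Pi.single i 1 + Pi.single j 1))
          * v j) := by
      simp only [dotProduct, Matrix.mulVec, Matrix.neg_apply, Matrix.of_apply, Pi.star_apply,
        star_trivial]
      rw [pow_two, Finset.sum_mul_sum, Finset.mul_sum, ← Finset.sum_sub_distrib]
      refine Finset.sum_congr rfl fun i _ => ?_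
      rw [Finset.mul_sum, Finset.mul_sum, Finset.mul_sum, ← Finset.sum_sub_distrib]
      refine Finset.sum_congr rfl fun j _ => ?_
      rw [add_right_comm β (Pi.single j 1)]
      ring
    rw [e]
    linarith
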